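/- For every n ≥ 3, the number of full perfect matchings of 2n points on a circle having exactly C(n,2) − (n−1) crossing pairs equals C(2n−2, n−1) − n, where C(·,·) denotes the binomial coefficient. -/

import Mathlib

/-- `M` is a perfect matching of the `2n` points `0, 1, …, 2n-1` placed in clockwise
order on a circle: a set of pairwise disjoint unordered pairs covering all `2n` points. -/
def IsPerfectMatching (n : ℕ) (M : Finset (Finset ℕ)) : Prop :=
  (∀ p ∈ M, p.card = 2) ∧
  (∀ p ∈ M, ∀ x ∈ p, x < 2 * n) ∧
  (∀ p ∈ M, ∀ q ∈ M, p ≠ q → Disjoint p q) ∧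
  (∀ x, x < 2 * n → ∃ p ∈ M, x ∈ p)

/-- The chord `V_i V_j` (where the boundary vertex `V_i` lies between points `2i-2` and
`2i-1`, and `1 ≤ i < j ≤ n`) is a dividing line for `M` if no pair of `M` has exactly one
element in `{2i-1, …, 2j-2}`. -/
def IsDividingLine (n i j : ℕ) (M : Finset (Finset ℕ)) : Prop :=
  1 ≤ i ∧ i < j ∧ j ≤ n ∧
    ∀ p ∈ M, (p ∩ Finset.Icc (2 * i - 1) (2 * j - 2)).card ≠ 1

/-- `M` is full if it has no dividing line. -/
def IsFull (n : ℕ) (M : Finset (Finset ℕ)) : Prop :=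
  ∀ i j, ¬ IsDividingLine n i j M


/-- Two pairs cross if their endpoints interleave around the circle, i.e. they can be
written as `{a,b}` and `{c,d}` with `a < c < b < d`. -/
def Crosses (p q : Finset ℕ) : Prop :=
  ∃ a b c d : ℕ, a < c ∧ c < b ∧ b < d ∧
    ((p = {a, b} ∧ q = {c, d}) ∨ (p = {c, d} ∧ q = {a, b}))

/-- The number of (unordered) crossing pairs of chords of `M`. -/
noncomputable def crossingCount (M : Finset (Finset ℕ)) : ℕ :=
  Set.ncard {s : Finset (Finset ℕ) | ∃ p ∈ M, ∃ q ∈ M, Crosses p q ∧ s = {p, q}}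

section

open Finset PowerSeries

theorem Crosses.symm {p q : Finset ℕ} (h : Crosses p q) : Crosses q p := by
  obtain ⟨a, b, c, d, hac, hcb, hbd, h⟩ := h
  exact ⟨a, b, c, d, hac, hcb, hbd, h.symm.imp And.symm And.symm⟩

theorem Crosses.ne {p q : Finset ℕ} (h : Crosses p q) : p ≠ q := by
  obtain ⟨a, b, c, d, hac, hcb, hbd, ⟨rfl, rfl⟩ | ⟨rfl, rfl⟩⟩ := h
  · intro h
    have : a ∈ ({c, d} : Finset ℕ) := h ▸ by simp
    simp at this; omega
  · intro h
    have : a ∈ ({c, d} : Finset ℕ) := h ▸ by simp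
    simp at this; omega

theorem pair_eq_pair_of_lt {a b c d : ℕ} (hab : a < b) (hcd : c < d)
    (h : ({a, b} : Finset ℕ) = {c, d}) : a = c ∧ b = d := by
  have h1 : a ∈ ({c, d} : Finset ℕ) := by simp [← h]
  have h2 : b ∈ ({c, d} : Finset ℕ) := by simp [← h]
  simp only [mem_insert, mem_singleton] at h1 h2
  omega

theorem not_crosses_self (p : Finset ℕ) : ¬ Crosses p p := fun h => h.ne rfl

/-- `M` is a perfect matching of the finite set `S`. -/
def IsMatchingOn (S : Finset ℕ) (M : Finset (Finset ℕ)) : Prop :=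
  (∀ p ∈ M, p.card = 2) ∧ (∀ p ∈ M, p ⊆ S) ∧
  (∀ p ∈ M, ∀ q ∈ M, p ≠ q → Disjoint p q) ∧ (∀ x ∈ S, ∃ p ∈ M, x ∈ p)

theorem isPerfectMatching_iff (n : ℕ) (M : Finset (Finset ℕ)) :
    IsPerfectMatching n M ↔ IsMatchingOn (range (2 * n)) M := by
  simp [IsPerfectMatching, IsMatchingOn, subset_iff]

namespace IsMatchingOn

variable {S p : Finset ℕ} {M : Finset (Finset ℕ)}

theorem two_mul_card (h : IsMatchingOn S M) : 2 * M.card = S.card := by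
  have hS : S = M.biUnion id := by
    ext x
    simp only [mem_biUnion, id]
    exact ⟨fun hx => h.2.2.2 x hx, fun ⟨p, hp, hx⟩ => h.2.1 p hp hx⟩
  rw [hS, card_biUnion (t := id) (fun p hp q hq hpq => h.2.2.1 p hp q hq hpq),
    mul_comm]
  exact (sum_const_nat h.1).symm

theorem eq_of_mem (h : IsMatchingOn S M) {q : Finset ℕ} (hp : p ∈ M) (hq : q ∈ M) {x : ℕ}
    (hxp : x ∈ p) (hxq : x ∈ q) : p = q := by
  by_contra hne
  exact disjoint_left.1 (h.2.2.1 p hp q hq hne) hxp hxq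

theorem erase_chord (h : IsMatchingOn S M) (hp : p ∈ M) : IsMatchingOn (S \ p) (M.erase p) := by
  refine ⟨fun q hq => h.1 q (mem_of_mem_erase hq), fun q hq => ?_,
    fun q hq r hr => h.2.2.1 q (mem_of_mem_erase hq) r (mem_of_mem_erase hr), fun x hx => ?_⟩
  · rw [mem_erase] at hq
    exact subset_sdiff.2 ⟨h.2.1 q hq.2, h.2.2.1 q hq.2 p hp hq.1⟩
  · rw [mem_sdiff] at hx
    obtain ⟨q, hq, hxq⟩ := h.2.2.2 x hx.1
    exact ⟨q, mem_erase.2 ⟨fun e => hx.2 (e ▸ hxq), hq⟩, hxq⟩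

theorem notMem_of_sdiff (h : IsMatchingOn (S \ p) M) (hp : p.card = 2) : p ∉ M := by
  intro hpM
  have hd : Disjoint p p := (subset_sdiff.1 (h.2.1 p hpM)).2
  rw [disjoint_self_iff_empty] at hd
  simp [hd] at hp

theorem insert_chord (h : IsMatchingOn (S \ p) M) (hpS : p ⊆ S) (hp : p.card = 2) :
    IsMatchingOn S (insert p M) := by
  have hd : ∀ q ∈ M, Disjoint q p := fun q hq => (subset_sdiff.1 (h.2.1 q hq)).2
  refine ⟨?_, ?_, ?_, fun x hx => ?_⟩
  · simpa [hp] using h.1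
  · simpa [hpS] using fun q hq => (h.2.1 q hq).trans sdiff_subset
  · intro q hq r hr hqr
    rw [mem_insert] at hq hr
    obtain rfl | hq := hq <;> obtain rfl | hr := hr
    · exact absurd rfl hqr
    · exact (hd r hr).symm
    · exact hd q hq
    · exact h.2.2.1 q hq r hr hqr
  · by_cases hxp : x ∈ p
    · exact ⟨p, mem_insert_self _ _, hxp⟩
    · obtain ⟨q, hq, hxq⟩ := h.2.2.2 x (mem_sdiff.2 ⟨hx, hxp⟩)
      exact ⟨q, mem_insert_of_mem hq, hxq⟩

end IsMatchingOn

open Classical in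
/-- The number of unordered pairs of distinct non-crossing chords of `M`. -/
noncomputable def noncrossingCount (M : Finset (Finset ℕ)) : ℕ :=
  #{s ∈ M.powersetCard 2 | ¬ ∃ p ∈ s, ∃ q ∈ s, Crosses p q}

theorem crossingCount_add_noncrossingCount (M : Finset (Finset ℕ)) :
    crossingCount M + noncrossingCount M = M.card.choose 2 := by
  classical
  have h : {s : Finset (Finset ℕ) | ∃ p ∈ M, ∃ q ∈ M, Crosses p q ∧ s = {p, q}} =
      ({s ∈ M.powersetCard 2 | ∃ p ∈ s, ∃ q ∈ s, Crosses p q} : Finset (Finset (Finset ℕ))) := by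
    ext s
    simp only [Set.mem_ofPred_eq, coe_filter, mem_powersetCard]
    constructor
    · rintro ⟨p, hp, q, hq, hc, rfl⟩
      exact ⟨⟨by simp [insert_subset_iff, hp, hq], card_pair hc.ne⟩, p, by simp, q, by simp, hc⟩
    · rintro ⟨⟨hs, h2⟩, p, hp, q, hq, hc⟩
      refine ⟨p, hs hp, q, hs hq, hc, (eq_of_subset_of_card_le ?_ ?_).symm⟩
      · simp [insert_subset_iff, hp, hq]
      · rw [h2, card_pair hc.ne]
  rw [crossingCount, h, Set.ncard_coe_finset, noncrossingCount, card_filter_add_card_filter_not,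
    card_powersetCard]

theorem noncrossingCount_empty : noncrossingCount ∅ = 0 := by
  classical
  simp [noncrossingCount]

open Classical in
theorem noncrossingCount_insert {p : Finset ℕ} {M : Finset (Finset ℕ)} (hp : p ∉ M) :
    noncrossingCount (insert p M) = noncrossingCount M + #{q ∈ M | ¬ Crosses p q} := by
  rw [noncrossingCount, powersetCard_succ_insert hp, filter_union, card_union_of_disjoint,
    noncrossingCount]
  · congr 1
    rw [powersetCard_one, map_eq_image, image_image, filter_image, card_image_of_injOn]
    · congr 1
      refine filter_congr fun q _ => ?_
      have hc : Crosses q p ↔ Crosses p q := ⟨Crosses.symm, Crosses.symm⟩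
      simp [not_crosses_self, hc]
    · intro q hq r hr h
      simp only [coe_filter, Set.mem_ofPred_eq] at hq hr
      have hmem : q ∈ (insert p {r} : Finset (Finset ℕ)) := by
        have e : (insert p {q} : Finset (Finset ℕ)) = insert p {r} := h
        simp [← e]
      simp only [mem_insert, mem_singleton] at hmem
      exact hmem.resolve_left fun e => hp (e ▸ hq.1)
  · rw [disjoint_left]
    intro s hs hs'
    simp only [mem_filter, mem_powersetCard, mem_image] at hs hs'
    obtain ⟨⟨t, -, rfl⟩, -⟩ := hs'
    exact hp (hs.1.1 (mem_insert_self _ _))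

open Classical in
/-- The perfect matchings of `A ∪ B` in which no chord lies inside `A`. -/
noncomputable def matchingsFrom (A B : Finset ℕ) : Finset (Finset (Finset ℕ)) :=
  {M ∈ (A ∪ B).powerset.powerset | IsMatchingOn (A ∪ B) M ∧ ∀ p ∈ M, ¬ p ⊆ A}

theorem mem_matchingsFrom {A B : Finset ℕ} {M : Finset (Finset ℕ)} :
    M ∈ matchingsFrom A B ↔ IsMatchingOn (A ∪ B) M ∧ ∀ p ∈ M, ¬ p ⊆ A := by
  simp only [matchingsFrom, mem_filter, mem_powerset, and_iff_right_iff_imp]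
  exact fun h p hp => mem_powerset.2 (h.1.2.1 p hp)

theorem mem_matchingsFrom_empty {S : Finset ℕ} {M : Finset (Finset ℕ)} :
    M ∈ matchingsFrom ∅ S ↔ IsMatchingOn S M := by
  rw [mem_matchingsFrom, empty_union, and_iff_left_iff_imp]
  intro h p hp hpe
  have := h.1 p hp
  simp [subset_empty.1 hpe] at this

theorem matchingsFrom_eq_empty {A B : Finset ℕ} (hAB : Disjoint A B) (h : B.card < A.card) :
    matchingsFrom A B = ∅ := by
  rw [eq_empty_iff_forall_notMem]
  intro M hM
  obtain ⟨hM, hA⟩ := mem_matchingsFrom.1 hM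
  have h2 := hM.two_mul_card
  rw [card_union_of_disjoint hAB] at h2
  have hle : A.card ≤ M.card := by
    have hf : ∀ a ∈ A, ∃ p ∈ M, a ∈ p := fun a ha => hM.2.2.2 a (mem_union_left _ ha)
    choose! f hf hmem using hf
    refine card_le_card_of_injOn f hf fun a ha a' ha' e => ?_
    by_contra hne
    refine hA _ (hf a ha) ?_
    have hp : ({a, a'} : Finset ℕ) = f a := eq_of_subset_of_card_le
      (by simp [insert_subset_iff, hmem a ha, e ▸ hmem a' ha'])
      (by rw [card_pair hne, hM.1 _ (hf a ha)])
    rw [← hp]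
    simpa [insert_subset_iff] using ⟨ha, ha'⟩
  omega

theorem matchingsFrom_empty_empty : matchingsFrom ∅ ∅ = {∅} := by
  ext M
  rw [mem_matchingsFrom_empty, mem_singleton]
  constructor
  · intro h
    simpa using h.two_mul_card
  · rintro rfl
    simp [IsMatchingOn]

section

variable {A B : Finset ℕ} {b : ℕ}

theorem union_insert_sdiff_pair (hAb : ∀ a ∈ A, a < b) (hbB : ∀ x ∈ B, b < x) {i : ℕ}
    (hi : i ∈ A) : (A ∪ insert b B) \ {i, b} = A.erase i ∪ B := by
  have := hAb i hi
  ext x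
  have h1 := hAb x
  have h2 := hbB x
  simp only [mem_sdiff, mem_union, mem_insert, mem_singleton, mem_erase]
  grind

theorem matchingsFrom_insert (hAb : ∀ a ∈ A, a < b) (hbB : ∀ x ∈ B, b < x) :
    matchingsFrom A (insert b B) = matchingsFrom (insert b A) B ∪
      A.biUnion fun i => (matchingsFrom (A.erase i) B).image (insert {i, b}) := by
  have hU : A ∪ insert b B = insert b A ∪ B := by simp
  ext M
  simp only [mem_union, mem_biUnion, mem_image]
  constructor
  · intro hM
    rw [mem_matchingsFrom] at hM
    obtain ⟨hM, hA⟩ := hM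
    by_cases h : ∃ i ∈ A, {i, b} ∈ M
    · right
      obtain ⟨i, hi, hp⟩ := h
      refine ⟨i, hi, M.erase {i, b}, mem_matchingsFrom.2 ⟨?_, fun p hp hpA => ?_⟩,
        insert_erase hp⟩
      · rw [← union_insert_sdiff_pair hAb hbB hi]
        exact hM.erase_chord hp
      · exact hA p (mem_of_mem_erase hp) (hpA.trans (erase_subset _ _))
    · left
      refine mem_matchingsFrom.2 ⟨hU ▸ hM, fun p hp hpA => ?_⟩
      have hbp : b ∈ p := by
        by_contra hb
        exact hA p hp ((subset_insert_iff_of_notMem hb).1 hpA)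
      obtain ⟨i, hi⟩ := card_eq_one.1 (show (p.erase b).card = 1 by
        rw [card_erase_of_mem hbp, hM.1 p hp])
      have hip : i ∈ p.erase b := by simp [hi]
      rw [mem_erase] at hip
      refine h ⟨i, (mem_insert.1 (hpA hip.2)).resolve_left hip.1, ?_⟩
      rwa [pair_comm, ← hi, insert_erase hbp]
  · rintro (hM | ⟨i, hi, M, hM, rfl⟩)
    · rw [mem_matchingsFrom] at hM ⊢
      exact ⟨hU ▸ hM.1, fun p hp hpA => hM.2 p hp (hpA.trans (subset_insert _ _))⟩
    · rw [mem_matchingsFrom] at hM ⊢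
      rw [← union_insert_sdiff_pair hAb hbB hi] at hM
      have hib := hAb i hi
      refine ⟨hM.1.insert_chord (by simp [insert_subset_iff, hi]) (card_pair hib.ne), ?_⟩
      intro p hp hpA
      obtain rfl | hp' := mem_insert.1 hp
      · exact (hAb b (hpA (by simp))).false
      · refine hM.2 p hp' fun x hx => mem_erase.2 ⟨?_, hpA hx⟩
        rintro rfl
        have := hM.1.2.1 p hp' hx
        simp at this

theorem matchingsFrom_insert_notMem (hAb : ∀ a ∈ A, a < b) (hbB : ∀ x ∈ B, b < x) {i : ℕ}
    (hi : i ∈ A) {M : Finset (Finset ℕ)} (hM : M ∈ matchingsFrom (A.erase i) B) :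
    {i, b} ∉ M := by
  rw [mem_matchingsFrom, ← union_insert_sdiff_pair hAb hbB hi] at hM
  exact hM.1.notMem_of_sdiff (card_pair (hAb i hi).ne)

open Classical in
theorem card_filter_crosses (hAb : ∀ a ∈ A, a < b) (hbB : ∀ x ∈ B, b < x) {i : ℕ}
    (hi : i ∈ A) {M : Finset (Finset ℕ)} (hM : M ∈ matchingsFrom (A.erase i) B) :
    #{q ∈ M | Crosses {i, b} q} = #{a ∈ A | i < a} := by
  obtain ⟨hM, hA⟩ := mem_matchingsFrom.1 hM
  have hf : ∀ a ∈ A.erase i, ∃ p ∈ M, a ∈ p := fun a ha => hM.2.2.2 a (mem_union_left _ ha)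
  choose! f hf hmem using hf
  have he : ∀ a ∈ A, i < a → a ∈ A.erase i := fun a ha h => mem_erase.2 ⟨h.ne', ha⟩
  refine (card_nbij f ?_ ?_ ?_).symm
  · intro a ha
    rw [mem_coe, mem_filter] at ha
    have hai := he a ha.1 ha.2
    obtain ⟨x, hx, hxA⟩ := not_subset.1 (hA _ (hf a hai))
    have hxB := (mem_union.1 (hM.2.1 _ (hf a hai) hx)).resolve_left hxA
    have hax : a ≠ x := fun e => hxA (e ▸ hai)
    have hp : ({a, x} : Finset ℕ) = f a := eq_of_subset_of_card_le
      (by simp [insert_subset_iff, hmem a hai, hx])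
      (by rw [card_pair hax, hM.1 _ (hf a hai)])
    rw [mem_coe, mem_filter]
    exact ⟨hf a hai, i, b, a, x, ha.2, hAb a ha.1, hbB x hxB, Or.inl ⟨rfl, hp.symm⟩⟩
  · intro a ha a' ha' e
    simp only [coe_filter, Set.mem_ofPred_eq] at ha ha'
    have hai := he a ha.1 ha.2
    have hai' := he a' ha'.1 ha'.2
    by_contra hne
    refine hA _ (hf a hai) ?_
    have hp : ({a, a'} : Finset ℕ) = f a := eq_of_subset_of_card_le
      (by simp [insert_subset_iff, hmem a hai, e ▸ hmem a' hai'])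
      (by rw [card_pair hne, hM.1 _ (hf a hai)])
    rw [← hp, insert_subset_iff, singleton_subset_iff]
    exact ⟨hai, hai'⟩
  · intro q hq
    simp only [coe_filter, Set.mem_ofPred_eq] at hq
    obtain ⟨hq, hc⟩ := hq
    have hy : ∃ y ∈ q, i < y ∧ y < b := by
      have hib := hAb i hi
      obtain ⟨a₁, b₁, c, d, hac, hcb, hbd, ⟨h1, rfl⟩ | ⟨h1, rfl⟩⟩ := hc
      · obtain ⟨rfl, rfl⟩ := pair_eq_pair_of_lt hib (hac.trans hcb) h1
        exact ⟨c, by simp, hac, hcb⟩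
      · obtain ⟨rfl, rfl⟩ := pair_eq_pair_of_lt hib (hcb.trans hbd) h1
        exact ⟨b₁, by simp, hcb, hbd⟩
    obtain ⟨y, hyq, hiy, hyb⟩ := hy
    have hyA : y ∈ A.erase i := (mem_union.1 (hM.2.1 q hq hyq)).resolve_right fun h =>
      (hbB y h).not_gt hyb
    refine ⟨y, ?_, hM.eq_of_mem (hf y hyA) hq (hmem y hyA) hyq⟩
    simpa [hiy] using mem_of_mem_erase hyA

open Classical in
theorem card_filter_not_crosses (hAb : ∀ a ∈ A, a < b) (hbB : ∀ x ∈ B, b < x) {i u : ℕ}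
    (hi : i ∈ A) (hu : B.card + 1 = 2 * u + A.card)
    {M : Finset (Finset ℕ)} (hM : M ∈ matchingsFrom (A.erase i) B) :
    #{q ∈ M | ¬ Crosses {i, b} q} = u + #{a ∈ A | a < i} := by
  have h1 := card_filter_crosses hAb hbB hi hM
  have h2 := (mem_matchingsFrom.1 hM).1.two_mul_card
  have h3 := card_filter_add_card_filter_not (s := M) (fun q => Crosses {i, b} q)
  have hd : Disjoint (A.erase i) B := disjoint_left.2 fun x hx hxB =>
    (hAb x (mem_of_mem_erase hx)).not_gt (hbB x hxB)
  rw [card_union_of_disjoint hd, card_erase_of_mem hi] at h2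
  have h4 := card_filter_add_card_filter_not (s := A.erase i) (fun a => a < i)
  rw [card_erase_of_mem hi] at h4
  have h5 : {a ∈ A.erase i | a < i} = {a ∈ A | a < i} := by
    ext x; simp only [mem_filter, mem_erase]; grind
  have h6 : {a ∈ A.erase i | ¬ a < i} = {a ∈ A | i < a} := by
    ext x; simp only [mem_filter, mem_erase]; grind
  rw [h5, h6] at h4
  have := card_pos.2 ⟨i, hi⟩
  omega

/-- The generating function of `matchingsFrom A B` by number of non-crossing pairs. -/
noncomputable def matchingGF (A B : Finset ℕ) : ℤ⟦X⟧ :=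
  ∑ M ∈ matchingsFrom A B, X ^ noncrossingCount M

theorem matchingGF_insert (hAb : ∀ a ∈ A, a < b) (hbB : ∀ x ∈ B, b < x) {u : ℕ}
    (hu : B.card + 1 = 2 * u + A.card) :
    matchingGF A (insert b B) = matchingGF (insert b A) B +
      X ^ u * ∑ i ∈ A, X ^ #{a ∈ A | a < i} * matchingGF (A.erase i) B := by
  classical
  have hb : ∀ i ∈ A, ∀ M ∈ (matchingsFrom (A.erase i) B).image (insert {i, b}), {i, b} ∈ M := by
    intro i _ M hM
    obtain ⟨M, -, rfl⟩ := mem_image.1 hM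
    exact mem_insert_self _ _
  have hm : ∀ i ∈ A, ∀ M ∈ (matchingsFrom (A.erase i) B).image (insert {i, b}),
      M ∈ matchingsFrom A (insert b B) := by
    intro i hi M hM
    rw [matchingsFrom_insert hAb hbB]
    exact mem_union_right _ (mem_biUnion.2 ⟨i, hi, hM⟩)
  rw [matchingGF, matchingsFrom_insert hAb hbB, sum_union, sum_biUnion, mul_sum, matchingGF]
  · congr 1
    refine sum_congr rfl fun i hi => ?_
    rw [sum_image, matchingGF, mul_sum, mul_sum]
    · refine sum_congr rfl fun M hM => ?_
      rw [noncrossingCount_insert (matchingsFrom_insert_notMem hAb hbB hi hM),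
        card_filter_not_crosses hAb hbB hi hu hM]
      ring
    · intro M hM M' hM' e
      rw [← erase_insert (matchingsFrom_insert_notMem hAb hbB hi hM), e,
        erase_insert (matchingsFrom_insert_notMem hAb hbB hi hM')]
  · intro i hi j hj hij
    refine disjoint_left.2 fun M hM hM' => hij ?_
    have he := (mem_matchingsFrom.1 (hm i hi M hM)).1.eq_of_mem (hb i hi M hM) (hb j hj M hM')
      (x := b) (by simp) (by simp)
    have : i ∈ ({j, b} : Finset ℕ) := by simp [← he]
    simpa [(hAb i hi).ne] using this
  · refine disjoint_left.2 fun M hM hM' => ?_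
    obtain ⟨i, hi, hM'⟩ := mem_biUnion.1 hM'
    refine (mem_matchingsFrom.1 hM).2 _ (hb i hi M hM') ?_
    simp [insert_subset_iff, hi]

theorem matchingGF_empty_empty : matchingGF ∅ ∅ = 1 := by
  simp [matchingGF, matchingsFrom_empty_empty, noncrossingCount_empty]

theorem matchingGF_eq_zero (hAB : Disjoint A B) (h : B.card < A.card) : matchingGF A B = 0 := by
  rw [matchingGF, matchingsFrom_eq_empty hAB h, sum_empty]

end

theorem sum_pow_card_filter_lt {R : Type*} [CommRing R] (x : R) (A : Finset ℕ) :
    (1 - x) * ∑ i ∈ A, x ^ #{a ∈ A | a < i} = 1 - x ^ #A := by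
  induction A using induction_on_max with
  | empty => simp
  | insert m s hm ih =>
    have hms : m ∉ s := fun h => (hm m h).false
    have h1 : ∀ i ∈ s, {a ∈ insert m s | a < i} = {a ∈ s | a < i} := fun i hi => by
      rw [filter_insert, if_neg (hm i hi).not_gt]
    have h2 : {a ∈ insert m s | a < m} = s := by
      rw [filter_insert, if_neg (lt_irrefl m), filter_true_of_mem hm]
    rw [sum_insert hms, h2, sum_congr rfl fun i hi => by rw [h1 i hi], mul_add, ih,
      card_insert_of_notMem hms]
    ring

theorem matchingGF_of_card_eq (A B : Finset ℕ) (hAB : ∀ a ∈ A, ∀ b ∈ B, a < b)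
    (h : B.card = A.card) :
    matchingGF A B * (1 - X) ^ A.card = ∏ i ∈ Ioc 0 A.card, (1 - X ^ i) := by
  induction B using induction_on_min generalizing A with
  | empty =>
    have : A = ∅ := card_eq_zero.1 (by simpa using h.symm)
    simp [this, matchingGF_empty_empty]
  | insert b B hb ih =>
    have hbB : b ∉ B := fun h => (hb b h).false
    rw [card_insert_of_notMem hbB] at h
    have hAb : ∀ a ∈ A, a < b := fun a ha => hAB a ha b (mem_insert_self _ _)
    have hbA : b ∉ A := fun h => (hAb b h).false
    have h0 : matchingGF (insert b A) B = 0 := by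
      refine matchingGF_eq_zero ?_ ?_
      · refine disjoint_left.2 fun x hx hxB => ?_
        obtain rfl | hx := mem_insert.1 hx
        · exact hbB hxB
        · exact ((hAb x hx).trans (hb x hxB)).false
      · rw [card_insert_of_notMem hbA]; omega
    have hi : ∀ i ∈ A, matchingGF (A.erase i) B * (1 - X) ^ B.card =
        ∏ j ∈ Ioc 0 B.card, (1 - X ^ j) := fun i hi => by
      have hc : (A.erase i).card = B.card := by rw [card_erase_of_mem hi]; omega
      have := ih (A.erase i)
        (fun a ha c hc => hAB a (mem_of_mem_erase ha) c (mem_insert_of_mem hc)) hc.symm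
      rwa [hc] at this
    rw [matchingGF_insert hAb hb (u := 0) (by omega), h0, ← h, ← insert_Ioc_right_eq_Ioc_add_one
      (Nat.zero_le _), prod_insert (by simp), h, ← sum_pow_card_filter_lt (X : ℤ⟦X⟧), ← h, zero_add,
      pow_zero, one_mul, sum_mul, mul_assoc, sum_mul, mul_sum]
    refine sum_congr rfl fun i hiA => ?_
    rw [← hi i hiA]
    ring

theorem pow_dvd_prod_one_sub_pow_sub_one {R : Type*} [CommRing R] (x : R) (m N : ℕ) :
    x ^ m ∣ ∏ i ∈ Ioc m N, (1 - x ^ i) - 1 := by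
  refine prod_induction (fun i => 1 - x ^ i) (fun y => x ^ m ∣ y - 1) ?_ (by simp) fun i hi => ?_
  · intro a b ha hb
    have : a * b - 1 = (a - 1) * b + (b - 1) := by ring
    rw [this]
    exact dvd_add (ha.mul_right _) hb
  · rw [mem_Ioc] at hi
    have : 1 - x ^ i - 1 = - x ^ i := by ring
    rw [this, dvd_neg]
    exact pow_dvd_pow _ hi.1.le

theorem X_pow_dvd_matchingGF_sub (N u : ℕ) (A B : Finset ℕ) (hAB : ∀ a ∈ A, ∀ b ∈ B, a < b)
    (h : B.card = 2 * u + A.card) (hN : u + A.card ≤ N) :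
    X ^ (u + A.card) ∣
      matchingGF A B * (1 - X) ^ (u + A.card) - ∏ i ∈ Ioc u N, (1 - X ^ i) := by
  induction B using induction_on_min generalizing A u with
  | empty =>
    have h1 : u + A.card = 0 := by simp at h; omega
    simp [h1]
  | insert b B hb ih =>
    obtain _ | u := u
    · rw [zero_add] at *
      rw [matchingGF_of_card_eq A _ hAB (by omega),
        ← prod_Ioc_consecutive _ (Nat.zero_le _) hN]
      have hd := pow_dvd_prod_one_sub_pow_sub_one (X : ℤ⟦X⟧) A.card N
      rw [← dvd_neg, neg_sub, ← mul_sub_one]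
      exact hd.mul_left _
    have hbB : b ∉ B := fun h => (hb b h).false
    rw [card_insert_of_notMem hbB] at h
    have hAb : ∀ a ∈ A, a < b := fun a ha => hAB a ha b (mem_insert_self _ _)
    have hbA : b ∉ A := fun h => (hAb b h).false
    have hopen := ih u (insert b A)
      (fun a ha c hc => (mem_insert.1 ha).elim (fun e => e ▸ hb c hc)
        fun ha => hAB a ha c (mem_insert_of_mem hc))
      (by rw [card_insert_of_notMem hbA]; omega) (by rw [card_insert_of_notMem hbA]; omega)
    rw [card_insert_of_notMem hbA, ← add_assoc, add_right_comm,
      ← prod_Ioc_consecutive _ u.le_succ (by omega : u + 1 ≤ N)] at hopen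
    have hclose : ∀ i ∈ A, X ^ (u + A.card) ∣
        matchingGF (A.erase i) B * (1 - X) ^ (u + A.card) - ∏ j ∈ Ioc (u + 1) N, (1 - X ^ j) := by
      intro i hi
      have hpos := card_pos.2 ⟨i, hi⟩
      have hc := card_erase_of_mem hi
      have he : u + 1 + (A.erase i).card = u + A.card := by omega
      have := ih (u + 1) (A.erase i)
        (fun a ha c hc => hAB a (mem_of_mem_erase ha) c (mem_insert_of_mem hc))
        (by omega) (by omega)
      rwa [he] at this
    rw [matchingGF_insert hAb hb (u := u + 1) (by omega)]
    set P : ℤ⟦X⟧ := ∏ j ∈ Ioc (u + 1) N, (1 - X ^ j)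
    have key : (matchingGF (insert b A) B +
          X ^ (u + 1) * ∑ i ∈ A, X ^ #{a ∈ A | a < i} * matchingGF (A.erase i) B) *
          (1 - X) ^ (u + 1 + A.card) - P =
        (matchingGF (insert b A) B * (1 - X) ^ (u + 1 + A.card) - (1 - X ^ (u + 1)) * P) +
        X ^ (u + 1) * (1 - X) * ∑ i ∈ A, X ^ #{a ∈ A | a < i} *
          (matchingGF (A.erase i) B * (1 - X) ^ (u + A.card) - P) -
        X ^ (u + 1 + A.card) * P := by
      have hs := sum_pow_card_filter_lt (X : ℤ⟦X⟧) A
      simp only [mul_sub, sum_sub_distrib, ← sum_mul, ← mul_assoc]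
      linear_combination (X ^ (u + 1) * P) * hs
    rw [key]
    refine dvd_sub (dvd_add (by simpa using hopen) ?_) (dvd_mul_right _ _)
    have hX : (X : ℤ⟦X⟧) ^ (u + 1 + A.card) ∣ X ^ (u + 1) * X ^ (u + A.card) := by
      rw [← pow_add]; exact pow_dvd_pow _ (by omega)
    refine hX.trans ?_
    rw [mul_assoc]
    exact mul_dvd_mul_left _ ((dvd_sum fun i hi => (hclose i hi).mul_left _).mul_left _)

theorem X_pow_dvd_matchingGF_empty_sub {n : ℕ} {S : Finset ℕ} (hS : S.card = 2 * n) :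
    X ^ n ∣ matchingGF ∅ S * (1 - X) ^ n - 1 := by
  simpa using X_pow_dvd_matchingGF_sub n n ∅ S (by simp) (by simpa using hS) (by simp)

open Classical in
theorem coeff_matchingGF (A B : Finset ℕ) (k : ℕ) :
    coeff k (matchingGF A B) = #{M ∈ matchingsFrom A B | noncrossingCount M = k} := by
  simp [matchingGF, coeff_X_pow, sum_boole, eq_comm]

/-- Every set of even size has a unique perfect matching all of whose chords cross. -/
theorem existsUnique_noncrossingCount_eq_zero {n : ℕ} {S : Finset ℕ} (hS : S.card = 2 * n) :
    ∃! M, IsMatchingOn S M ∧ noncrossingCount M = 0 := by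
  classical
  have h1 : coeff 0 (matchingGF ∅ S) = 1 := by
    obtain rfl | hn := n.eq_zero_or_pos
    · rw [card_eq_zero.1 (by simpa using hS : S.card = 0), matchingGF_empty_empty]
      simp
    · have h := (X_dvd_iff.1 ((dvd_pow_self _ hn.ne').trans (X_pow_dvd_matchingGF_empty_sub hS)))
      simpa [sub_eq_zero] using h
  rw [coeff_matchingGF] at h1
  obtain ⟨M, hM⟩ := card_eq_one.1 (Nat.cast_eq_one.1 h1)
  have hiff : ∀ M', IsMatchingOn S M' ∧ noncrossingCount M' = 0 ↔ M' = M := fun M' => by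
    rw [← mem_singleton (a := M), ← hM, mem_filter, mem_matchingsFrom_empty]
  exact ⟨M, (hiff M).2 rfl, fun M' h => (hiff M').1 h⟩

open Classical in
theorem card_matchings_noncrossingCount {n k : ℕ} (hk : k < n) {S : Finset ℕ}
    (hS : S.card = 2 * n) :
    #{M ∈ matchingsFrom ∅ S | noncrossingCount M = k} = (n - 1 + k).choose (n - 1) := by
  have hu := invOneSubPow_val_eq_mk_sub_one_add_choose_of_pos ℤ n (by omega)
  have hinv : (1 - X : ℤ⟦X⟧) ^ n * (invOneSubPow ℤ n).val = 1 := by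
    rw [← invOneSubPow_inv_eq_one_sub_pow]
    exact (invOneSubPow ℤ n).inv_val
  have hd : X ^ n ∣ matchingGF ∅ S - (invOneSubPow ℤ n).val := by
    have := (X_pow_dvd_matchingGF_empty_sub hS).mul_right (invOneSubPow ℤ n).val
    rwa [sub_mul, mul_assoc, hinv, mul_one, one_mul] at this
  have hc := X_pow_dvd_iff.1 hd k hk
  rw [map_sub, sub_eq_zero, coeff_matchingGF, hu, coeff_mk] at hc
  exact_mod_cast hc

theorem noncrossingCount_union {M₁ M₂ : Finset (Finset ℕ)} (hd : Disjoint M₁ M₂)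
    (h : ∀ p ∈ M₁, ∀ q ∈ M₂, ¬ Crosses p q) :
    noncrossingCount (M₁ ∪ M₂) =
      noncrossingCount M₁ + noncrossingCount M₂ + M₁.card * M₂.card := by
  classical
  induction M₁ using Finset.induction_on with
  | empty => simp [noncrossingCount_empty]
  | insert p M₁ hp ih =>
    rw [disjoint_insert_left] at hd
    have hf : #{q ∈ M₁ ∪ M₂ | ¬ Crosses p q} = #{q ∈ M₁ | ¬ Crosses p q} + M₂.card := by
      rw [filter_union, card_union_of_disjoint (disjoint_filter_filter hd.2),
        filter_true_of_mem (s := M₂) fun q hq => h p (mem_insert_self _ _) q hq]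
    rw [insert_union, noncrossingCount_insert (by simp [hp, hd.1]), noncrossingCount_insert hp,
      ih hd.2 fun q hq => h q (mem_insert_of_mem hq), hf, card_insert_of_notMem hp]
    ring

theorem crosses_of_noncrossingCount_eq_zero {M : Finset (Finset ℕ)} (h : noncrossingCount M = 0)
    {p q : Finset ℕ} (hp : p ∈ M) (hq : q ∈ M) (hpq : p ≠ q) : Crosses p q := by
  classical
  rw [noncrossingCount, card_eq_zero, filter_eq_empty_iff] at h
  have hs := h (mem_powersetCard.2
    ⟨(by simp [insert_subset_iff, hp, hq] : ({p, q} : Finset _) ⊆ M), card_pair hpq⟩)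
  have hc : Crosses q p ↔ Crosses p q := ⟨Crosses.symm, Crosses.symm⟩
  simpa [not_crosses_self, hc] using hs

/-- The chords that join two cyclically adjacent points with no boundary vertex between them:
`{2k-1, 2k}` for `0 < k < n`, and `{0, 2n-1}` for `k = 0`. -/
def shortChord (n k : ℕ) : Finset ℕ :=
  if k = 0 then {0, 2 * n - 1} else {2 * k - 1, 2 * k}

theorem card_shortChord {n k : ℕ} (hk : k < n) : (shortChord n k).card = 2 := by
  unfold shortChord
  split_ifs <;> exact card_pair (by omega)

theorem shortChord_subset {n k : ℕ} (hk : k < n) : shortChord n k ⊆ range (2 * n) := by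
  unfold shortChord
  split_ifs <;> simp [insert_subset_iff] <;> omega

theorem shortChord_injOn (n : ℕ) : Set.InjOn (shortChord n) (Set.Iio n) := by
  intro k hk l hl h
  rw [Set.mem_Iio] at hk hl
  unfold shortChord at h
  split_ifs at h
  · omega
  all_goals
    have := pair_eq_pair_of_lt (by omega) (by omega) h
    omega

theorem not_crosses_shortChord {n k : ℕ} {q : Finset ℕ} (hq : q ⊆ range (2 * n)) :
    ¬ Crosses (shortChord n k) q := by
  rintro ⟨a, b, c, d, hac, hcb, hbd, ⟨h, rfl⟩ | ⟨h, rfl⟩⟩ <;>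
  simp only [insert_subset_iff, singleton_subset_iff, mem_range] at hq <;>
  unfold shortChord at h <;> split_ifs at h <;>
  have := pair_eq_pair_of_lt (by omega) (by omega) h <;>
  omega

theorem IsMatchingOn.filter_subset {S I : Finset ℕ} {M : Finset (Finset ℕ)}
    (hM : IsMatchingOn S M) (hI : I ⊆ S) (h : ∀ p ∈ M, p ⊆ I ∨ Disjoint p I) :
    IsMatchingOn I {p ∈ M | p ⊆ I} := by
  refine ⟨fun p hp => hM.1 p (mem_of_mem_filter p hp), fun p hp => (mem_filter.1 hp).2,
    fun p hp q hq => hM.2.2.1 p (mem_of_mem_filter p hp) q (mem_of_mem_filter q hq),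
    fun x hx => ?_⟩
  obtain ⟨p, hp, hxp⟩ := hM.2.2.2 x (hI hx)
  exact ⟨p, mem_filter.2 ⟨hp, (h p hp).resolve_right fun hd => disjoint_left.1 hd hxp hx⟩, hxp⟩

theorem IsMatchingOn.filter_not_subset {S I : Finset ℕ} {M : Finset (Finset ℕ)}
    (hM : IsMatchingOn S M) (h : ∀ p ∈ M, p ⊆ I ∨ Disjoint p I) :
    IsMatchingOn (S \ I) {p ∈ M | ¬ p ⊆ I} := by
  refine ⟨fun p hp => hM.1 p (mem_of_mem_filter p hp), fun p hp => ?_,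
    fun p hp q hq => hM.2.2.1 p (mem_of_mem_filter p hp) q (mem_of_mem_filter q hq),
    fun x hx => ?_⟩
  · rw [mem_filter] at hp
    exact subset_sdiff.2 ⟨hM.2.1 p hp.1, (h p hp.1).resolve_left hp.2⟩
  · rw [mem_sdiff] at hx
    obtain ⟨p, hp, hxp⟩ := hM.2.2.2 x hx.1
    exact ⟨p, mem_filter.2 ⟨hp, fun hpI => hx.2 (hpI hxp)⟩, hxp⟩

theorem IsMatchingOn.eq_singleton {S : Finset ℕ} {M : Finset (Finset ℕ)} (hM : IsMatchingOn S M)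
    (h : M.card = 1) : M = {S} := by
  obtain ⟨p, rfl⟩ := card_eq_one.1 h
  have h2 := hM.two_mul_card
  have hp := mem_singleton_self p
  rw [eq_of_subset_of_card_le (hM.2.1 p hp) (by rw [← h2, hM.1 p hp, h])]

theorem not_crosses_of_subset_Icc {l r : ℕ} {p q : Finset ℕ} (hp : p ⊆ Icc l r)
    (hq : Disjoint q (Icc l r)) : ¬ Crosses p q := by
  rw [disjoint_left] at hq
  rintro ⟨a, b, c, d, hac, hcb, hbd, ⟨rfl, rfl⟩ | ⟨rfl, rfl⟩⟩ <;>
  simp only [insert_subset_iff, singleton_subset_iff, mem_Icc, mem_insert, mem_singleton,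
    forall_eq_or_imp, forall_eq] at hp hq <;>
  omega

theorem exists_shortChord_of_not_isFull {n : ℕ} {M : Finset (Finset ℕ)}
    (hM : IsMatchingOn (range (2 * n)) M) (hfull : ¬ IsFull n M)
    (hnc : noncrossingCount M = n - 1) :
    ∃ k < n, shortChord n k ∈ M ∧ noncrossingCount (M.erase (shortChord n k)) = 0 := by
  simp only [IsFull, not_forall, not_not] at hfull
  obtain ⟨i, j, hi, hij, hj, hline⟩ := hfull
  set I := Icc (2 * i - 1) (2 * j - 2) with hI
  have hIS : I ⊆ range (2 * n) := fun x hx => by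
    rw [hI, mem_Icc] at hx
    rw [mem_range]
    omega
  have hIcard : I.card = 2 * (j - i) := by rw [hI, Nat.card_Icc]; omega
  have hsplit : ∀ p ∈ M, p ⊆ I ∨ Disjoint p I := fun p hp => by
    have h2 := hM.1 p hp
    have h1 := hline p hp
    have hle := card_le_card (inter_subset_left : p ∩ I ⊆ p)
    obtain h0 | h0 : (p ∩ I).card = 0 ∨ (p ∩ I).card = 2 := by omega
    · exact Or.inr (disjoint_iff_inter_eq_empty.2 (card_eq_zero.1 h0))
    · exact Or.inl (inter_eq_left.1 (eq_of_subset_of_card_le inter_subset_left (by omega)))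
  have h1 := hM.filter_subset hIS hsplit
  have h2 := hM.filter_not_subset hsplit
  have hM12 := filter_union_filter_not_eq (fun p => p ⊆ I) M
  have hd := disjoint_filter_filter_not M M (fun p => p ⊆ I)
  have hnc12 := noncrossingCount_union hd fun p hp q hq => by
    rw [mem_filter] at hp hq
    exact not_crosses_of_subset_Icc hp.2 ((hsplit q hq.1).resolve_left hq.2)
  rw [hM12, hnc] at hnc12
  have hc1 := h1.two_mul_card
  have hc2 := h2.two_mul_card
  rw [card_sdiff_of_subset hIS, card_range] at hc2
  have he1 : M \ {p ∈ M | p ⊆ I} = {p ∈ M | ¬ p ⊆ I} := by rw [filter_not]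
  have he2 : M \ {p ∈ M | ¬ p ⊆ I} = {p ∈ M | p ⊆ I} := by
    rw [filter_not, Finset.sdiff_sdiff_eq_self (filter_subset _ _)]
  have hs1 : {p ∈ M | p ⊆ I} ⊆ M := filter_subset _ _
  have hs2 : {p ∈ M | ¬ p ⊆ I} ⊆ M := filter_subset _ _
  generalize {p ∈ M | p ⊆ I} = M₁ at *
  generalize {p ∈ M | ¬ p ⊆ I} = M₂ at *
  obtain ⟨a, ha⟩ : ∃ a, M₁.card = a + 1 := ⟨M₁.card - 1, by omega⟩
  obtain ⟨c, hc⟩ : ∃ c, M₂.card = c + 1 := ⟨M₂.card - 1, by omega⟩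
  have hn : n = a + c + 2 := by omega
  have hprod : (a + 1) * (c + 1) = a * c + a + c + 1 := by ring
  rw [ha, hc, hprod] at hnc12
  have hac : a * c = 0 := by omega
  obtain rfl | rfl := mul_eq_zero.1 hac
  · rw [h1.eq_singleton ha] at he1 hs1
    have hII : I = shortChord n i := by
      rw [shortChord, if_neg (by omega)]
      ext x
      simp only [hI, mem_Icc, mem_insert, mem_singleton]
      omega
    rw [hII] at hs1 he1
    refine ⟨i, by omega, singleton_subset_iff.1 hs1, ?_⟩
    rw [erase_eq, he1]
    omega
  · rw [h2.eq_singleton hc] at he2 hs2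
    have hII : range (2 * n) \ I = shortChord n 0 := by
      rw [shortChord, if_pos rfl]
      ext x
      simp only [hI, mem_sdiff, mem_range, mem_Icc, mem_insert, mem_singleton]
      omega
    rw [hII] at hs2 he2
    refine ⟨0, by omega, singleton_subset_iff.1 hs2, ?_⟩
    rw [erase_eq, he2]
    omega

theorem not_isFull_of_shortChord_mem {n k : ℕ} (hn : 2 ≤ n) (hk : k < n) {M : Finset (Finset ℕ)}
    (hM : IsMatchingOn (range (2 * n)) M) (hkM : shortChord n k ∈ M) : ¬ IsFull n M := by
  intro hfull
  have hdisj : ∀ p ∈ M, p ≠ shortChord n k → Disjoint p (shortChord n k) := fun p hp hne =>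
    hM.2.2.1 p hp _ hkM hne
  obtain rfl | hk0 := k.eq_zero_or_pos
  · refine hfull 1 n ⟨le_rfl, by omega, le_rfl, fun p hp => ?_⟩
    have hI : Icc (2 * 1 - 1) (2 * n - 2) = range (2 * n) \ shortChord n 0 := by
      rw [shortChord, if_pos rfl]
      ext x
      simp only [mem_sdiff, mem_range, mem_Icc, mem_insert, mem_singleton]
      omega
    rw [hI]
    by_cases h : p = shortChord n 0
    · simp [h]
    · rw [inter_eq_left.2 (subset_sdiff.2 ⟨hM.2.1 p hp, hdisj p hp h⟩), hM.1 p hp]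
      decide
  · refine hfull k (k + 1) ⟨hk0, by omega, hk, fun p hp => ?_⟩
    have hI : Icc (2 * k - 1) (2 * (k + 1) - 2) = shortChord n k := by
      rw [shortChord, if_neg hk0.ne']
      ext x
      simp only [mem_Icc, mem_insert, mem_singleton]
      omega
    rw [hI]
    by_cases h : p = shortChord n k
    · rw [h, inter_self, card_shortChord hk]
      decide
    · simp [disjoint_iff_inter_eq_empty.1 (hdisj p hp h)]

open Classical in
theorem card_not_isFull {n : ℕ} (hn : 3 ≤ n) :
    #{M ∈ matchingsFrom ∅ (range (2 * n)) | noncrossingCount M = n - 1 ∧ ¬ IsFull n M} = n := by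
  have hcard : ∀ k < n, (range (2 * n) \ shortChord n k).card = 2 * (n - 1) := fun k hk => by
    rw [card_sdiff_of_subset (shortChord_subset hk), card_range, card_shortChord hk]
    omega
  have hex : ∀ k < n, ∃! M, IsMatchingOn (range (2 * n) \ shortChord n k) M ∧
      noncrossingCount M = 0 := fun k hk => existsUnique_noncrossingCount_eq_zero (hcard k hk)
  choose! g hg huniq using hex
  have hnot : ∀ k < n, shortChord n k ∉ g k := fun k hk =>
    (hg k hk).1.notMem_of_sdiff (card_shortChord hk)
  have hins : ∀ k < n, IsMatchingOn (range (2 * n)) (insert (shortChord n k) (g k)) := fun k hk =>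
    (hg k hk).1.insert_chord (shortChord_subset hk) (card_shortChord hk)
  have hgcard : ∀ k < n, (g k).card = n - 1 := fun k hk => by
    have := (hg k hk).1.two_mul_card
    rw [hcard k hk] at this
    omega
  conv_rhs => rw [← card_range n]
  refine (card_nbij (fun k => insert (shortChord n k) (g k)) ?_ ?_ ?_).symm
  · intro k hk
    replace hk : k < n := by simpa using hk
    rw [mem_coe, mem_filter, mem_matchingsFrom_empty, noncrossingCount_insert (hnot k hk),
      (hg k hk).2, filter_true_of_mem fun q hq => not_crosses_shortChord
        ((hins k hk).2.1 q (mem_insert_of_mem hq)), hgcard k hk, zero_add]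
    exact ⟨hins k hk, rfl,
      not_isFull_of_shortChord_mem (by omega) hk (hins k hk) (mem_insert_self _ _)⟩
  · intro k hk l hl h
    replace hk : k < n := by simpa using hk
    replace hl : l < n := by simpa using hl
    change insert (shortChord n k) (g k) = insert (shortChord n l) (g l) at h
    by_contra hne
    have hlk : shortChord n l ∈ g k := by
      have : shortChord n l ∈ insert (shortChord n k) (g k) := h ▸ mem_insert_self _ _
      exact (mem_insert.1 this).resolve_left fun e => hne (shortChord_injOn n hl hk e).symm
    obtain ⟨r, hr, hrl⟩ := exists_mem_ne (by rw [hgcard k hk]; omega) (shortChord n l)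
    exact not_crosses_shortChord ((hins k hk).2.1 r (mem_insert_of_mem hr))
      (crosses_of_noncrossingCount_eq_zero (hg k hk).2 hlk hr hrl.symm)
  · intro M hM
    rw [mem_coe, mem_filter, mem_matchingsFrom_empty] at hM
    obtain ⟨k, hk, hkM, h0⟩ := exists_shortChord_of_not_isFull hM.1 hM.2.2 hM.2.1
    refine ⟨k, by simpa using hk, ?_⟩
    change insert (shortChord n k) (g k) = M
    rw [← huniq k hk _ ⟨hM.1.erase_chord hkM, h0⟩, insert_erase hkM]

end

/-- For every `n ≥ 3`, the number of full perfect matchings of `2n` points on a circle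
with exactly `C(n,2) - (n-1)` crossing pairs equals `C(2n-2, n-1) - n`. -/
theorem count_full_matchings_corank_n_sub_one (n : ℕ) (hn : 3 ≤ n) :
    Set.ncard {M : Finset (Finset ℕ) |
        IsPerfectMatching n M ∧ IsFull n M ∧
          crossingCount M = n.choose 2 - (n - 1)} =
      (2 * n - 2).choose (n - 1) - n := by
  classical
  have hset : {M : Finset (Finset ℕ) | IsPerfectMatching n M ∧ IsFull n M ∧
      crossingCount M = n.choose 2 - (n - 1)} =
      ({M ∈ matchingsFrom ∅ (Finset.range (2 * n)) | noncrossingCount M = n - 1 ∧ IsFull n M} :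
        Finset (Finset (Finset ℕ))) := by
    ext M
    simp only [Set.mem_ofPred_eq, Finset.coe_filter, mem_matchingsFrom_empty,
      isPerfectMatching_iff]
    refine and_congr_right fun hM => ?_
    rw [and_comm (a := IsFull n M)]
    refine and_congr_left fun _ => ?_
    have h := crossingCount_add_noncrossingCount M
    have hc := hM.two_mul_card
    rw [Finset.card_range] at hc
    rw [show M.card = n by omega] at h
    have hle : n - 1 ≤ n.choose 2 := by
      rw [Nat.choose_two_right, Nat.le_div_iff_mul_le two_pos, mul_comm]
      exact Nat.mul_le_mul_right _ (by omega)
    omega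
  rw [hset, Set.ncard_coe_finset]
  have htotal := card_matchings_noncrossingCount (k := n - 1) (by omega)
    (Finset.card_range (2 * n))
  rw [← Finset.card_filter_add_card_filter_not (IsFull n), Finset.filter_filter,
    Finset.filter_filter, card_not_isFull hn, ← two_mul, Nat.mul_sub, mul_one] at htotal
  omega
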